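/- Let Z⁺, X_i, X_i⁺ ∈ S_{n,p}, A_i ∈ ℝ^{n×m_i}, β_i > 0, δ_i ≥ 0, σ̲ ∈ (0,1), ρ ≥ 1, d ≥ 1. Set Λ_i := Λ(X_i;A_i), Λ_i⁺ := Λ(X_i⁺;A_i), and H_i := A_i A_iᵀ + Λ_i + β_i Z⁺(Z⁺)ᵀ. Assume: distp(Z⁺, X_i⁺)² ≤ 2(1 − σ̲²); ‖P_{X_i⁺} H_i X_i⁺‖_F ≤ δ_i ‖P_{X_i} H_i X_i‖_F; ‖Λ_i⁺ − Λ_i‖_F ≤ 4‖A_i‖₂² distp(X_i⁺, X_i); √2 σ̲ β_i − 8‖A_i‖₂² > 0; σ̲ − 2√(ρd) δ_i > 0; and β_i ≥ 4(2√(ρd) + √2)‖A_i‖₂² / (σ̲ − 2√(ρd) δ_i). Then distp(Z⁺, X_i⁺) ≤ (1/√(2ρd)) · distp(Z⁺, X_i). -/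

import Mathlib

open Matrix BigOperators

/-- Frobenius norm of a real matrix. -/
noncomputable def frob {n m : ℕ} (A : Matrix (Fin n) (Fin m) ℝ) : ℝ :=
  Real.sqrt (∑ i, ∑ j, (A i j) ^ 2)

/-- Spectral (operator 2-) norm of a real matrix. -/
noncomputable def spec {n m : ℕ} (A : Matrix (Fin n) (Fin m) ℝ) : ℝ :=
  ‖LinearMap.toContinuousLinearMap (Matrix.toEuclideanLin A)‖

/-- Projection distance `distp(X,Z) = ‖XXᵀ − ZZᵀ‖_F`. -/
noncomputable def distp {n p : ℕ} (X Z : Matrix (Fin n) (Fin p) ℝ) : ℝ :=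
  frob (X * Xᵀ - Z * Zᵀ)

/-- The low-rank multiplier `Λ(X;A) = XW(X;A)ᵀ + W(X;A)Xᵀ` with
`W(X;A) = −(I − XXᵀ)AAᵀX`. -/
noncomputable def LamW {n p m : ℕ} (X : Matrix (Fin n) (Fin p) ℝ)
    (A : Matrix (Fin n) (Fin m) ℝ) : Matrix (Fin n) (Fin n) ℝ :=
  X * (-((1 - X * Xᵀ) * (A * Aᵀ) * X))ᵀ + (-((1 - X * Xᵀ) * (A * Aᵀ) * X)) * Xᵀ

/-- The local matrix `H = AAᵀ + Λ(X;A) + β Z⁺(Z⁺)ᵀ`. -/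
noncomputable def Hmat {n p m : ℕ} (X : Matrix (Fin n) (Fin p) ℝ)
    (A : Matrix (Fin n) (Fin m) ℝ) (β : ℝ)
    (Zplus : Matrix (Fin n) (Fin p) ℝ) : Matrix (Fin n) (Fin n) ℝ :=
  A * Aᵀ + LamW X A + β • (Zplus * Zplusᵀ)

open scoped Matrix.Norms.Frobenius

section FrobeniusNorm

variable {n m k p : ℕ}

theorem frob_eq_norm (M : Matrix (Fin n) (Fin m) ℝ) : frob M = ‖M‖ := by
  rw [frob, Matrix.frobenius_norm_def, Real.sqrt_eq_rpow]
  simp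

theorem frob_sq (M : Matrix (Fin n) (Fin m) ℝ) : frob M ^ 2 = trace (Mᵀ * M) := by
  rw [frob, Real.sq_sqrt (by positivity), Finset.sum_comm]
  simp [trace, Matrix.mul_apply, sq]

theorem frob_nonneg (M : Matrix (Fin n) (Fin m) ℝ) : 0 ≤ frob M := Real.sqrt_nonneg _

theorem frob_transpose (M : Matrix (Fin n) (Fin m) ℝ) : frob Mᵀ = frob M := by
  rw [frob_eq_norm, frob_eq_norm, Matrix.frobenius_norm_transpose]

theorem frob_add_le (M N : Matrix (Fin n) (Fin m) ℝ) : frob (M + N) ≤ frob M + frob N := by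
  simpa only [frob_eq_norm] using norm_add_le M N

theorem frob_sub_comm (M N : Matrix (Fin n) (Fin m) ℝ) : frob (M - N) = frob (N - M) := by
  simpa only [frob_eq_norm] using norm_sub_rev M N

theorem frob_smul_of_nonneg {c : ℝ} (hc : 0 ≤ c) (M : Matrix (Fin n) (Fin m) ℝ) :
    frob (c • M) = c * frob M := by
  simp only [frob_eq_norm, norm_smul, Real.norm_of_nonneg hc]

theorem frob_mul_le (M : Matrix (Fin n) (Fin m) ℝ) (N : Matrix (Fin m) (Fin k) ℝ) :
    frob (M * N) ≤ frob M * frob N := by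
  simpa only [frob_eq_norm] using Matrix.frobenius_norm_mul M N

/-- Gram matrix of the component orthogonal to the column space of `X`. -/
theorem gram_complement {X : Matrix (Fin n) (Fin p) ℝ} (hX : Xᵀ * X = 1)
    (M : Matrix (Fin n) (Fin m) ℝ) :
    ((1 - X * Xᵀ) * M)ᵀ * ((1 - X * Xᵀ) * M) = Mᵀ * M - (Xᵀ * M)ᵀ * (Xᵀ * M) := by
  have h : Xᵀ * (X * (Xᵀ * M)) = Xᵀ * M := by rw [← Matrix.mul_assoc, hX, Matrix.one_mul]
  simp only [transpose_mul, transpose_sub, transpose_transpose, Matrix.mul_sub,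
    Matrix.sub_mul, Matrix.one_mul, Matrix.mul_assoc, h]
  abel

theorem frob_sq_complement {X : Matrix (Fin n) (Fin p) ℝ} (hX : Xᵀ * X = 1)
    (M : Matrix (Fin n) (Fin m) ℝ) :
    frob ((1 - X * Xᵀ) * M) ^ 2 = frob M ^ 2 - frob (Xᵀ * M) ^ 2 := by
  simp only [frob_sq, gram_complement hX, trace_sub]

theorem frob_complement_mul_le {X : Matrix (Fin n) (Fin p) ℝ} (hX : Xᵀ * X = 1)
    (M : Matrix (Fin n) (Fin m) ℝ) : frob ((1 - X * Xᵀ) * M) ≤ frob M := by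
  refine (sq_le_sq₀ (frob_nonneg _) (frob_nonneg _)).1 ?_
  nlinarith [frob_sq_complement hX M, sq_nonneg (frob (Xᵀ * M))]

theorem frob_mul_le_of_orthonormal {X : Matrix (Fin n) (Fin p) ℝ} (hX : Xᵀ * X = 1)
    (M : Matrix (Fin m) (Fin n) ℝ) : frob (M * X) ≤ frob M := by
  rw [← frob_transpose (M * X), ← frob_transpose M, transpose_mul]
  refine (sq_le_sq₀ (frob_nonneg _) (frob_nonneg _)).1 ?_
  nlinarith [frob_sq_complement hX Mᵀ, sq_nonneg (frob ((1 - X * Xᵀ) * Mᵀ))]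

theorem frob_mul_transpose_of_orthonormal {Z : Matrix (Fin n) (Fin p) ℝ} (hZ : Zᵀ * Z = 1)
    (M : Matrix (Fin m) (Fin p) ℝ) : frob (M * Zᵀ) = frob M := by
  rw [← frob_transpose (M * Zᵀ), ← frob_transpose M,
    ← sq_eq_sq₀ (frob_nonneg _) (frob_nonneg _), frob_sq, frob_sq]
  have h : Zᵀ * (Z * Mᵀ) = Mᵀ := by rw [← Matrix.mul_assoc, hZ, Matrix.one_mul]
  simp only [transpose_mul, transpose_transpose, Matrix.mul_assoc, h]

end FrobeniusNorm

section ProjectionDistance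

variable {n p m : ℕ}

theorem distp_comm (X Z : Matrix (Fin n) (Fin p) ℝ) : distp X Z = distp Z X :=
  frob_sub_comm _ _

theorem distp_triangle (X Y Z : Matrix (Fin n) (Fin p) ℝ) :
    distp X Z ≤ distp X Y + distp Y Z := by
  simpa only [distp, sub_add_sub_cancel] using
    frob_add_le (X * Xᵀ - Y * Yᵀ) (Y * Yᵀ - Z * Zᵀ)

theorem distp_sq {X Z : Matrix (Fin n) (Fin p) ℝ} (hX : Xᵀ * X = 1) (hZ : Zᵀ * Z = 1) :
    distp Z X ^ 2 = 2 * frob ((1 - X * Xᵀ) * Z) ^ 2 := by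
  have hXX : Xᵀ * (X * Xᵀ) = Xᵀ := by rw [← Matrix.mul_assoc, hX, Matrix.one_mul]
  have hZZ : Zᵀ * (Z * Zᵀ) = Zᵀ := by rw [← Matrix.mul_assoc, hZ, Matrix.one_mul]
  have hX' : trace (X * Xᵀ) = p := by rw [trace_mul_comm, hX]; simp
  have hZ' : trace (Z * Zᵀ) = p := by rw [trace_mul_comm, hZ]; simp
  have h₁ : trace (Z * (Zᵀ * (X * Xᵀ))) = trace (Zᵀ * (X * (Xᵀ * Z))) := by
    rw [trace_mul_comm]; simp only [Matrix.mul_assoc]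
  have h₂ : trace (X * (Xᵀ * (Z * Zᵀ))) = trace (Zᵀ * (X * (Xᵀ * Z))) := by
    rw [← h₁, ← Matrix.mul_assoc, trace_mul_comm, Matrix.mul_assoc]
  rw [distp, frob_sq, frob_sq, gram_complement hX]
  simp only [transpose_mul, transpose_sub, transpose_transpose, Matrix.mul_sub,
    Matrix.sub_mul, Matrix.mul_assoc, hXX, hZZ, trace_sub, h₁, h₂, hX', hZ', hZ]
  simp only [trace_one, Fintype.card_fin]
  ring

theorem distp_eq {X Z : Matrix (Fin n) (Fin p) ℝ} (hX : Xᵀ * X = 1) (hZ : Zᵀ * Z = 1) :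
    distp Z X = √2 * frob ((1 - X * Xᵀ) * Z) := by
  rw [← sq_eq_sq₀ (show 0 ≤ distp Z X from frob_nonneg _) (mul_nonneg (Real.sqrt_nonneg _) (frob_nonneg _)),
    mul_pow, Real.sq_sqrt zero_le_two, distp_sq hX hZ]

theorem frob_complement_proj_mul_le {X Z : Matrix (Fin n) (Fin p) ℝ} (hX : Xᵀ * X = 1)
    (hZ : Zᵀ * Z = 1) :
    √2 * frob ((1 - X * Xᵀ) * (Z * Zᵀ) * X) ≤ distp Z X := by
  rw [distp_eq hX hZ]
  gcongr
  refine (frob_mul_le_of_orthonormal hX _).trans_eq ?_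
  rw [← Matrix.mul_assoc, frob_mul_transpose_of_orthonormal hZ]

theorem mul_distp_le_frob_complement_proj_mul {X Z : Matrix (Fin n) (Fin p) ℝ} {σ : ℝ}
    (hX : Xᵀ * X = 1) (hZ : Zᵀ * Z = 1) (hσ : 0 ≤ σ)
    (h : distp Z X ^ 2 ≤ 2 * (1 - σ ^ 2)) :
    σ * distp Z X ≤ √2 * frob ((1 - X * Xᵀ) * (Z * Zᵀ) * X) := by
  rw [distp_sq hX hZ] at h
  rw [distp_eq hX hZ, mul_left_comm]
  gcongr
  set Y := (1 - X * Xᵀ) * Z with hY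
  have hC : (Zᵀ * X) * (Zᵀ * X)ᵀ = 1 - Yᵀ * Y := by
    rw [hY, gram_complement hX, hZ, sub_sub_cancel, transpose_mul, transpose_mul,
      transpose_transpose, transpose_transpose]
  have hYC : (1 - X * Xᵀ) * (Z * Zᵀ) * X = Y * (Zᵀ * X) := by
    simp only [hY, Matrix.mul_assoc]
  clear_value Y
  have hquartic : trace (Y * (Yᵀ * Y) * Yᵀ) = trace ((Yᵀ * Y)ᵀ * (Yᵀ * Y)) := by
    rw [trace_mul_comm, transpose_mul, transpose_transpose, Matrix.mul_assoc]
  have hsq : frob (Y * (Zᵀ * X)) ^ 2 = frob Y ^ 2 - frob (Yᵀ * Y) ^ 2 := by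
    rw [← frob_transpose (Y * _), frob_sq, frob_sq, frob_sq, transpose_transpose,
      transpose_mul Y, ← Matrix.mul_assoc, Matrix.mul_assoc Y, hC, Matrix.mul_sub, Matrix.sub_mul,
      trace_sub, Matrix.mul_one, trace_mul_comm, hquartic]
  have hgram : frob (Yᵀ * Y) ≤ frob Y ^ 2 := by
    simpa only [frob_transpose, sq] using frob_mul_le Yᵀ Y
  rw [hYC]
  refine (sq_le_sq₀ (mul_nonneg hσ (frob_nonneg _)) (frob_nonneg _)).1 ?_
  have := pow_le_pow_left₀ (frob_nonneg _) hgram 2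
  nlinarith [mul_nonneg (sq_nonneg (frob Y)) (by linarith : 0 ≤ 1 - σ ^ 2 - frob Y ^ 2)]

/-- The multiplier makes `X` a stationary point of the local problem. -/
theorem complement_mul_add_LamW_mul {X : Matrix (Fin n) (Fin p) ℝ} (hX : Xᵀ * X = 1)
    (A : Matrix (Fin n) (Fin m) ℝ) :
    (1 - X * Xᵀ) * (A * Aᵀ + LamW X A) * X = 0 := by
  have hPX : (1 - X * Xᵀ) * X = 0 := by
    rw [Matrix.sub_mul, Matrix.mul_assoc, hX, Matrix.one_mul, Matrix.mul_one, sub_self]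
  have hPP : (1 - X * Xᵀ) * (1 - X * Xᵀ) = 1 - X * Xᵀ := by
    rw [Matrix.mul_sub, ← Matrix.mul_assoc, hPX, Matrix.zero_mul, Matrix.mul_one, sub_zero]
  have hΛX : (1 - X * Xᵀ) * LamW X A * X = -((1 - X * Xᵀ) * (A * Aᵀ) * X) := by
    rw [LamW, Matrix.mul_add, ← Matrix.mul_assoc _ X, hPX, Matrix.zero_mul, zero_add,
      Matrix.mul_assoc, Matrix.mul_assoc _ Xᵀ X, hX, Matrix.mul_one, Matrix.mul_neg,
      ← Matrix.mul_assoc, ← Matrix.mul_assoc, hPP]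
  rw [Matrix.mul_add, Matrix.add_mul, hΛX, add_neg_cancel]

theorem complement_mul_Hmat_mul {X Y : Matrix (Fin n) (Fin p) ℝ} (hY : Yᵀ * Y = 1)
    (A : Matrix (Fin n) (Fin m) ℝ) (β : ℝ) (Z : Matrix (Fin n) (Fin p) ℝ) :
    β • ((1 - Y * Yᵀ) * (Z * Zᵀ) * Y) =
      (1 - Y * Yᵀ) * Hmat X A β Z * Y + (1 - Y * Yᵀ) * (LamW Y A - LamW X A) * Y := by
  have hH : Hmat X A β Z + (LamW Y A - LamW X A) =
      (A * Aᵀ + LamW Y A) + β • (Z * Zᵀ) := by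
    rw [Hmat]; abel
  rw [← Matrix.add_mul, ← Matrix.mul_add, hH, Matrix.mul_add, Matrix.add_mul,
    complement_mul_add_LamW_mul hY, zero_add, Matrix.mul_smul, Matrix.smul_mul]

end ProjectionDistance

/-- under the KKT-violation decrease condition and parameter bounds, the
consensus error contracts by the factor `1/√(2ρd)`. -/
theorem stmt14 {n p m : ℕ}
    (Zplus Xi Xiplus : Matrix (Fin n) (Fin p) ℝ)
    (A : Matrix (Fin n) (Fin m) ℝ)
    (β δ σ ρ : ℝ) (d : ℕ)
    (hZplus : Zplusᵀ * Zplus = 1)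
    (hXi : Xiᵀ * Xi = 1) (hXiplus : Xiplusᵀ * Xiplus = 1)
    (hβ : 0 < β) (hδ : 0 ≤ δ)
    (hσ0 : 0 < σ) (hσ1 : σ < 1)
    (hρ : 1 ≤ ρ) (hd : 1 ≤ d)
    (hdist : distp Zplus Xiplus ^ 2 ≤ 2 * (1 - σ ^ 2))
    (hkkt : frob ((1 - Xiplus * Xiplusᵀ) * Hmat Xi A β Zplus * Xiplus)
      ≤ δ * frob ((1 - Xi * Xiᵀ) * Hmat Xi A β Zplus * Xi))
    (hΛ : frob (LamW Xiplus A - LamW Xi A) ≤ 4 * spec A ^ 2 * distp Xiplus Xi)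
    (hβ1 : Real.sqrt 2 * σ * β - 8 * spec A ^ 2 > 0)
    (hδ1 : σ - 2 * Real.sqrt (ρ * d) * δ > 0)
    (hβ2 : β ≥ 4 * (2 * Real.sqrt (ρ * d) + Real.sqrt 2) * spec A ^ 2
      / (σ - 2 * Real.sqrt (ρ * d) * δ)) :
    distp Zplus Xiplus ≤ (1 / Real.sqrt (2 * ρ * d)) * distp Zplus Xi := by
  set r := √(ρ * d)
  set a := spec A ^ 2
  set D := distp Zplus Xiplus
  set E := distp Zplus Xi
  have ha0 : 0 ≤ a := sq_nonneg _
  have hE0 : 0 ≤ E := frob_nonneg _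
  have hd' : (1 : ℝ) ≤ d := by exact_mod_cast hd
  have hr0 : 0 < r := Real.sqrt_pos.2 (by positivity)
  have hs0 : 0 < √2 := Real.sqrt_pos.2 two_pos
  have hs2 : √2 * √2 = 2 := Real.mul_self_sqrt zero_le_two
  have hlower := mul_distp_le_frob_complement_proj_mul hXiplus hZplus hσ0.le hdist
  have hupper := frob_complement_proj_mul_le hXi hZplus
  have hXE : frob ((1 - Xi * Xiᵀ) * Hmat Xi A β Zplus * Xi) =
      β * frob ((1 - Xi * Xiᵀ) * (Zplus * Zplusᵀ) * Xi) := by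
    rw [← frob_smul_of_nonneg hβ.le, complement_mul_Hmat_mul (X := Xi) hXi A, sub_self,
      Matrix.mul_zero, Matrix.zero_mul, add_zero]
  have hLam : frob ((1 - Xiplus * Xiplusᵀ) * (LamW Xiplus A - LamW Xi A) * Xiplus) ≤
      4 * a * (D + E) := by
    refine (frob_mul_le_of_orthonormal hXiplus _).trans
      ((frob_complement_mul_le hXiplus _).trans (hΛ.trans ?_))
    gcongr
    exact (distp_triangle Xiplus Zplus Xi).trans_eq (by rw [distp_comm Xiplus])
  have hplus : β * frob ((1 - Xiplus * Xiplusᵀ) * (Zplus * Zplusᵀ) * Xiplus) ≤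
      δ * (β * frob ((1 - Xi * Xiᵀ) * (Zplus * Zplusᵀ) * Xi)) + 4 * a * (D + E) := by
    rw [← frob_smul_of_nonneg hβ.le, complement_mul_Hmat_mul (X := Xi) hXiplus A, ← hXE]
    exact (frob_add_le _ _).trans (add_le_add hkkt hLam)
  -- combine the two-sided bounds with the multiplier estimate
  have hDE : (σ * β - 4 * √2 * a) * D ≤ (δ * β + 4 * √2 * a) * E := by
    have h₁ := mul_le_mul_of_nonneg_left hlower hβ.le
    have h₂ := mul_le_mul_of_nonneg_left hupper (mul_nonneg hδ hβ.le)
    have h₃ := mul_le_mul_of_nonneg_left hplus hs0.le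
    linarith
  have hpos : 0 < σ * β - 4 * √2 * a := by nlinarith
  have hs_le : √2 ≤ 2 := by nlinarith
  have hβ3 : 4 * (2 * r + √2) * a ≤ β * (σ - 2 * r * δ) := (div_le_iff₀ hδ1).1 hβ2
  have hcoef : √2 * r * (δ * β + 4 * √2 * a) ≤ σ * β - 4 * √2 * a := by
    have h₁ := mul_le_mul_of_nonneg_right hs_le (by positivity : 0 ≤ r * δ * β)
    have h₂ : √2 * r * (4 * √2 * a) = 8 * r * a := by linear_combination 4 * r * a * hs2
    linarith
  have hsqrt : √(2 * ρ * d) = √2 * r := by rw [mul_assoc, Real.sqrt_mul zero_le_two]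
  rw [hsqrt, one_div, inv_mul_eq_div, le_div_iff₀ (by positivity)]
  refine le_of_mul_le_mul_left ?_ hpos
  have h₁ := mul_le_mul_of_nonneg_left hDE (by positivity : 0 ≤ √2 * r)
  have h₂ := mul_le_mul_of_nonneg_right hcoef hE0
  linarith
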